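/- arXiv:1603.06870 — 2 statements merged into one kernel-verified Lean document; each statement's English description precedes it below -/
import Mathlib

section
/- Lemma on the relaxed payment–accuracy problem (Lemma 4): Assume the set argmax_{ε>0} D(ε)/V_LB(ε) is nonempty and has a least element ε̃, and for τ ∈ (0,1) let Ñ = ⌈ln(1/τ)/D(ε̃)⌉. Then for any N ∈ ℕ and any ε_1,…,ε_N ∈ (0,∞) with e^{−Σ_{i=1}^N D(ε_i)} ≤ τ, it holds that Σ_{i=1}^N V_LB(ε_i) ≥ (Ñ−1)·V_LB(ε̃). -/
open Real

/-- The lower bound `V_LB(ε)` on the value of `ε` units of privacy. -/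
noncomputable def VLB (θ : ℝ) (g' : ℝ → ℝ) (ε : ℝ) : ℝ :=
  g' ε * ((Real.exp ε + 1) / Real.exp ε) *
    ((θ / (2 * θ - 1)) * (Real.exp ε + 1) - 1)

/-- The per-individual Chernoff information `D(ε)`. -/
noncomputable def dExp (θ ε : ℝ) : ℝ :=
  (1/2) * Real.log ((Real.exp ε + 1)^2 /
    (4 * (θ * Real.exp ε + 1 - θ) * ((1 - θ) * Real.exp ε + θ)))

/-- The hypotheses on the privacy cost function `g` (with derivative `g'`). -/
structure ProperCost (g g' : ℝ → ℝ) : Prop where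
  conv : ConvexOn ℝ (Set.Ici 0) g
  deriv : ∀ x ∈ Set.Ici (0:ℝ), HasDerivAt g (g' x) x
  derivCont : ContinuousOn g' (Set.Ici 0)
  mono : MonotoneOn g (Set.Ici 0)
  nonneg : ∀ x ∈ Set.Ici (0:ℝ), 0 ≤ g x
  zero : g 0 = 0
  pos : ∀ x > (0:ℝ), 0 < g x

theorem ProperCost.deriv_pos {g g' : ℝ → ℝ} (hg : ProperCost g g') {ε : ℝ} (hε : 0 < ε) :
    0 < g' ε := by
  have h := hg.conv.slope_le_of_hasDerivAt (Set.mem_Ici.2 le_rfl) (Set.mem_Ici.2 hε.le) hε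
    (hg.deriv ε hε.le)
  rw [slope_def_field, hg.zero, sub_zero, sub_zero] at h
  exact (div_pos (hg.pos ε hε) hε).trans_le h

theorem VLB_pos {θ : ℝ} (hθ : 1/2 < θ) (hθ1 : θ < 1) {g g' : ℝ → ℝ} (hg : ProperCost g g')
    {ε : ℝ} (hε : 0 < ε) : 0 < VLB θ g' ε := by
  have hd := hg.deriv_pos hε
  have he := Real.exp_pos ε
  have hc : 1 < θ / (2 * θ - 1) := by
    rw [lt_div_iff₀ (by linarith)]
    linarith
  have hfac : 0 < θ / (2 * θ - 1) * (Real.exp ε + 1) - 1 := by nlinarith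
  unfold VLB
  positivity

theorem dExp_pos {θ : ℝ} (hθ : 1/2 < θ) (hθ1 : θ < 1) {ε : ℝ} (hε : 0 < ε) :
    0 < dExp θ ε := by
  have he : 1 < Real.exp ε := Real.one_lt_exp_iff.2 hε
  have ha : 0 < θ * Real.exp ε + 1 - θ := by nlinarith
  have hb : 0 < (1 - θ) * Real.exp ε + θ := by nlinarith
  have hab : 0 < (2 * θ - 1) * (Real.exp ε - 1) := mul_pos (by linarith) (by linarith)
  refine mul_pos (by norm_num) (Real.log_pos ?_)
  rw [one_lt_div (by positivity)]
  linear_combination pow_pos hab 2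

/-- **Lemma 4 (relaxed payment–accuracy problem).**
If `ε̃` is the least element of `argmax_{ε>0} D(ε)/V_LB(ε)` and
`Ñ = ⌈ln(1/τ)/D(ε̃)⌉`, then every feasible `(N, ε_1,…,ε_N)` of the relaxed problem
satisfies `Σ_i V_LB(ε_i) ≥ (Ñ−1)·V_LB(ε̃)`. -/
theorem relaxed_payment_accuracy_lower_bound
    (θ : ℝ) (hθ : 1/2 < θ) (hθ1 : θ < 1)
    (g g' : ℝ → ℝ) (hg : ProperCost g g')
    (εt : ℝ)
    (hεt : IsLeast {ε : ℝ | 0 < ε ∧ ∀ ε' : ℝ, 0 < ε' →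
      dExp θ ε' / VLB θ g' ε' ≤ dExp θ ε / VLB θ g' ε} εt)
    (τ : ℝ) (hτ0 : 0 < τ) (hτ1 : τ < 1)
    (N : ℕ) (eps : Fin N → ℝ) (heps : ∀ i, 0 < eps i)
    (hacc : Real.exp (-(∑ i : Fin N, dExp θ (eps i))) ≤ τ) :
    ((⌈Real.log (1/τ) / dExp θ εt⌉₊ : ℝ) - 1) * VLB θ g' εt ≤
      ∑ i : Fin N, VLB θ g' (eps i) := by
  obtain ⟨hεt0, hmax⟩ := hεt.1
  have hV := VLB_pos hθ hθ1 hg hεt0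
  have hD := dExp_pos hθ hθ1 hεt0
  have hlog : Real.log (1 / τ) ≤ ∑ i : Fin N, dExp θ (eps i) := by
    have := (Real.le_log_iff_exp_le hτ0).2 hacc
    rw [one_div, Real.log_inv]
    linarith
  have hlog0 : 0 ≤ Real.log (1 / τ) := Real.log_nonneg (one_le_one_div hτ0 hτ1.le)
  have hratio : ∀ i, dExp θ (eps i) / dExp θ εt * VLB θ g' εt ≤ VLB θ g' (eps i) := by
    intro i
    have h := hmax (eps i) (heps i)
    rw [div_le_div_iff₀ (VLB_pos hθ hθ1 hg (heps i)) hV] at h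
    rw [div_mul_eq_mul_div, div_le_iff₀ hD]
    linarith
  calc ((⌈Real.log (1/τ) / dExp θ εt⌉₊ : ℝ) - 1) * VLB θ g' εt
      ≤ Real.log (1/τ) / dExp θ εt * VLB θ g' εt := by
        have := Nat.ceil_lt_add_one (div_nonneg hlog0 hD.le)
        gcongr
        linarith
    _ ≤ (∑ i : Fin N, dExp θ (eps i)) / dExp θ εt * VLB θ g' εt := by gcongr
    _ = ∑ i : Fin N, dExp θ (eps i) / dExp θ εt * VLB θ g' εt := by
        rw [Finset.sum_div, Finset.sum_mul]
    _ ≤ ∑ i : Fin N, VLB θ g' (eps i) := Finset.sum_le_sum fun i _ => hratio i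
end

section
/- Structure of best responses, part 2 (symmetric or non-informative): Let K̄₁, K̄₀, K̄ be arbitrary reals and let ḡ : [0,∞] → [0,∞] be non-decreasing with ḡ(0) = 0 and ḡ(ξ) > 0 for every ξ ∈ (0,∞]. For (p₁,p₀) ∈ [0,1]², define ζ(p₁,p₀) = max{|ln(p₁/p₀)|, |ln((1−p₁)/(1−p₀))|} with the convention 0/0 = 1 (values in [0,∞]), and Ū(p₁,p₀) = K̄₁p₁ + K̄₀p₀ + K̄ − ḡ(ζ(p₁,p₀)) (valued in [−∞,∞)). Then every maximizer (p₁*, p₀*) of Ū over [0,1]² satisfies p₁* = p₀* or p₁* + p₀* = 1. -/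
open Real

/-- One absolute log-likelihood-ratio term `|ln(a/b)|`, valued in `[0,∞]`, with the
convention `0/0 = 1`. -/
noncomputable def llrA (a b : ℝ) : ENNReal :=
  if a = 0 ∧ b = 0 then 0
  else if a = 0 ∨ b = 0 then ⊤
  else ENNReal.ofReal |Real.log (a / b)|

/-- The differential-privacy level of the participating binary reporting strategy with
`P(X=1|S=1) = p₁` and `P(X=1|S=0) = p₀`. -/
noncomputable def zeta2 (p₁ p₀ : ℝ) : ENNReal :=
  llrA p₁ p₀ ⊔ llrA (1-p₁) (1-p₀)

lemma llrA_comm (a b : ℝ) : llrA a b = llrA b a := by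
  have h : |Real.log (a / b)| = |Real.log (b / a)| := by
    rw [← inv_div b a, Real.log_inv, abs_neg]
  simp only [llrA, and_comm, or_comm, h]

lemma llrA_div_div (a b : ℝ) {k : ℝ} (hk : k ≠ 0) : llrA (a / k) (b / k) = llrA a b := by
  simp [llrA, hk, div_div_div_cancel_right₀ hk]

lemma llrA_self (a : ℝ) : llrA a a = 0 := by
  by_cases h : a = 0 <;> simp [llrA, h]

lemma zeta2_self (a : ℝ) : zeta2 a a = 0 := by
  simp [zeta2, llrA_self]

lemma llrA_ne_zero {a b : ℝ} (ha : 0 ≤ a) (hb : 0 ≤ b) (hab : a ≠ b) : llrA a b ≠ 0 := by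
  unfold llrA
  split_ifs with h₁ h₂
  · exact absurd (h₁.1.trans h₁.2.symm) hab
  · exact ENNReal.top_ne_zero
  · push Not at h₂
    have ha' : 0 < a := lt_of_le_of_ne ha (Ne.symm h₂.1)
    have hb' : 0 < b := lt_of_le_of_ne hb (Ne.symm h₂.2)
    have hlog : Real.log (a / b) ≠ 0 :=
      Real.log_ne_zero_of_pos_of_ne_one (div_pos ha' hb')
        fun h => hab ((div_eq_one_iff_eq hb'.ne').1 h)
    simpa [ENNReal.ofReal_eq_zero] using hlog

/-- A strategy with positive privacy cost cannot weakly beat both a free endpoint `e` and a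
no more costly endpoint `s` when it lies on the segment from `e` to `s`, away from `s`. -/
lemma segment_not_optimal {e s p t : ℝ} {gs gp : ENNReal} (ht₀ : 0 ≤ t) (ht₁ : t < 1)
    (hp : p = (1 - t) * e + t * s) (hle : gs ≤ gp) (hpos : 0 < gp)
    (he : (e : EReal) ≤ (p : EReal) - (gp : EReal))
    (hs : (s : EReal) - (gs : EReal) ≤ (p : EReal) - (gp : EReal)) : False := by
  induction gp with
  | top => simp at he
  | coe gp =>
    lift gs to NNReal using ne_top_of_le_ne_top ENNReal.coe_ne_top hle
    have hle' : (gs : ℝ) ≤ gp := by exact_mod_cast hle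
    have hpos' : (0 : ℝ) < gp := by exact_mod_cast hpos
    simp only [EReal.coe_nnreal_eq_coe_real] at he hs
    have he' : e ≤ p - gp := by exact_mod_cast he
    have hs' : s - gs ≤ p - gp := by exact_mod_cast hs
    nlinarith [mul_nonneg ht₀ (by linarith : 0 ≤ p - s)]

/-- **Structure of best responses, part 2 (symmetric or non-informative):** for any
reals `K̄₁, K̄₀, K̄` and a privacy cost `ḡ : [0,∞] → [0,∞]` that is non-decreasing,
vanishes at `0` and is positive everywhere else, every maximizer of
`Ū(p₁,p₀) = K̄₁p₁ + K̄₀p₀ + K̄ − ḡ(ζ(p₁,p₀))` over `[0,1]²` satisfies `p₁ = p₀` or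
`p₁ + p₀ = 1`. -/
theorem best_response_symmetric_or_noninformative
    (K₁ K₀ K : ℝ)
    (gbar : ENNReal → ENNReal) (hmono : Monotone gbar) (h0 : gbar 0 = 0)
    (hpos : ∀ ξ : ENNReal, ξ ≠ 0 → 0 < gbar ξ)
    (U : ℝ × ℝ → EReal)
    (hU : U = fun v =>
      ((K₁ * v.1 + K₀ * v.2 + K : ℝ) : EReal) - (gbar (zeta2 v.1 v.2) : EReal))
    (v : ℝ × ℝ) (hv : v ∈ Set.Icc (0:ℝ) 1 ×ˢ Set.Icc (0:ℝ) 1)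
    (hmax : ∀ u ∈ Set.Icc (0:ℝ) 1 ×ˢ Set.Icc (0:ℝ) 1, U u ≤ U v) :
    v.1 = v.2 ∨ v.1 + v.2 = 1 := by
  obtain ⟨p₁, p₀⟩ := v
  obtain ⟨⟨h₁, h₁'⟩, h₀, h₀'⟩ := hv
  simp only at h₁ h₁' h₀ h₀' ⊢
  by_contra! hne
  obtain ⟨hne, hsum⟩ := hne
  have hg : 0 < gbar (zeta2 p₁ p₀) := hpos _ fun h =>
    llrA_ne_zero h₁ h₀ hne (le_antisymm (le_sup_left.trans h.le) bot_le)
  have hfree : ∀ a ∈ Set.Icc (0 : ℝ) 1, ((K₁ * a + K₀ * a + K : ℝ) : EReal) ≤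
      ((K₁ * p₁ + K₀ * p₀ + K : ℝ) : EReal) - (gbar (zeta2 p₁ p₀) : EReal) := by
    intro a ha
    simpa only [hU, zeta2_self, h0, EReal.coe_ennreal_zero, sub_zero] using
      hmax (a, a) ⟨ha, ha⟩
  have hsym : ∀ a b : ℝ, 0 ≤ a → 0 ≤ b → a + b = 1 →
      ((K₁ * a + K₀ * b + K : ℝ) : EReal) - (gbar (llrA a b) : EReal) ≤
      ((K₁ * p₁ + K₀ * p₀ + K : ℝ) : EReal) - (gbar (zeta2 p₁ p₀) : EReal) := by
    intro a b ha hb hab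
    have hz : zeta2 a b = llrA a b := by
      rw [zeta2, show 1 - a = b by linarith, show 1 - b = a by linarith, llrA_comm b a,
        sup_idem]
    simpa only [hU, hz] using
      hmax (a, b) ⟨⟨ha, by simp only; linarith⟩, hb, by simp only; linarith⟩
  rcases lt_or_gt_of_ne hsum with hlt | hgt
  · have ht : 0 < p₁ + p₀ := by
      by_contra! h
      exact hne (by linarith)
    refine segment_not_optimal (t := p₁ + p₀) ht.le hlt ?_ (hmono ?_) hg
      (hfree 0 (by simp)) (hsym (p₁ / (p₁ + p₀)) (p₀ / (p₁ + p₀)) (by positivity)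
        (by positivity) (by field_simp))
    · field_simp
      ring
    · rw [llrA_div_div _ _ ht.ne']
      exact le_sup_left
  · obtain ⟨t, ht_def⟩ : ∃ t, t = (1 - p₀) + (1 - p₁) := ⟨_, rfl⟩
    have ht : 0 < t := by
      by_contra! h
      exact hne (by linarith)
    refine segment_not_optimal (t := t) ht.le (by linarith) ?_ (hmono ?_) hg
      (hfree 1 (by simp)) (hsym ((1 - p₀) / t) ((1 - p₁) / t)
        (div_nonneg (by linarith) ht.le) (div_nonneg (by linarith) ht.le)
        (by rw [← add_div, ← ht_def, div_self ht.ne']))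
    · field_simp
      rw [ht_def]
      ring
    · rw [llrA_div_div _ _ ht.ne', llrA_comm]
      exact le_sup_right
end
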